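/- Let E = ⋃_m I_m, where I_m = [a_m, b_m] (a_m < b_m) are pairwise disjoint closed intervals in ℝ with dist(0, I_m) → ∞ as m → ∞. Let f be an entire function of the Cartwright class whose exponential type σ = limsup_{|z|→∞} log|f(z)|/|z| is strictly positive. If f is of bounded type in ℂ∖E, then there exist a function u : ℂ → ℝ, continuous on ℂ, equal to 0 on E, positive and harmonic on ℂ∖E, symmetric (u(conj z) = u(z) for all z), satisfying u(z) ≤ A(1+|z|) for some constant A, and a constant κ > 0 such that u(z) ≥ κ|Im z| for all z ∈ ℂ. -/

import Mathlib

open Complex Filter MeasureTheory Set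

noncomputable def logPlus (t : ℝ) : ℝ := max (Real.log t) 0

/-- `h` is harmonic on `U`: real-valued, `C²` on `U`, with vanishing Laplacian. -/
def HarmonicOn (h : ℂ → ℝ) (U : Set ℂ) : Prop :=
  ContDiffOn ℝ 2 h U ∧ ∀ z ∈ U,
    iteratedFDerivWithin ℝ 2 h U z ![1, 1] +
      iteratedFDerivWithin ℝ 2 h U z ![Complex.I, Complex.I] = 0

/-- The subset of `ℂ` corresponding to a subset of `ℝ`. -/
def cplx (E : Set ℝ) : Set ℂ := (fun x : ℝ => (x : ℂ)) '' E

/-- `g` is of bounded type in `U`: `log⁺|g|` admits a positive harmonic majorant on `U`. -/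
def BoundedTypeOn (g : ℂ → ℂ) (U : Set ℂ) : Prop :=
  ∃ h : ℂ → ℝ, HarmonicOn h U ∧ (∀ z ∈ U, 0 < h z) ∧
    ∀ z ∈ U, logPlus ‖g z‖ ≤ h z


open InnerProductSpace Metric Topology

noncomputable def PI (φ : ℂ → ℝ) (c : ℂ) (R : ℝ) (w : ℂ) : ℝ :=
  Real.circleAverage (poissonKernel c w • φ) c R

lemma pk_cont {c w : ℂ} {R : ℝ} (hw : w ∈ ball c R) :
    ContinuousOn (poissonKernel c w) (sphere c |R|) := by
  rw [poissonKernel_eq_re_herglotzRieszKernel]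
  exact Complex.continuous_re.comp_continuousOn (continuousOn_herglotzRieszKernel_sphere hw)

lemma pk_le {c w z : ℂ} {R : ℝ} (hw : w ∈ ball c R) (hz : z ∈ sphere c R) :
    poissonKernel c w z ≤ (R + ‖w - c‖) / (R - ‖w - c‖) := by
  rw [poissonKernel_eq_re_herglotzRieszKernel]
  exact re_herglotzRieszKernel_le hz hw

lemma pk_ge {c w z : ℂ} {R : ℝ} (hw : w ∈ ball c R) (hz : z ∈ sphere c R) :
    (R - ‖w - c‖) / (R + ‖w - c‖) ≤ poissonKernel c w z := by
  rw [poissonKernel_eq_re_herglotzRieszKernel]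
  exact le_re_herglotzRieszKernel hz hw

lemma pk_nonneg {c w z : ℂ} {R : ℝ} (hw : w ∈ ball c R) (hz : z ∈ sphere c R) :
    0 ≤ poissonKernel c w z := by
  have h1 : ‖w - c‖ < R := by simpa [dist_eq_norm] using hw
  exact le_trans (div_nonneg (by linarith) (by have := norm_nonneg (w - c); linarith)) (pk_ge hw hz)

lemma PI_mono {φ ψ : ℂ → ℝ} {c w : ℂ} {R : ℝ} (hw : w ∈ ball c R)
    (hφ : ContinuousOn φ (sphere c R)) (hψ : ContinuousOn ψ (sphere c R))
    (h : ∀ z ∈ sphere c R, φ z ≤ ψ z) : PI φ c R w ≤ PI ψ c R w := by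
  have hR : 0 < R := pos_of_mem_ball hw
  have hk := pk_cont hw
  have hR' : |R| = R := abs_of_pos hR
  unfold PI
  apply Real.circleAverage_mono
  · exact ContinuousOn.circleIntegrable' (by rw [hR'] at hk ⊢; exact hk.mul hφ)
  · exact ContinuousOn.circleIntegrable' (by rw [hR'] at hk ⊢; exact hk.mul hψ)
  · intro x hx
    rw [hR'] at hx
    exact mul_le_mul_of_nonneg_left (h x hx) (pk_nonneg hw hx)

lemma PI_harm {φ : ℂ → ℝ} {c w : ℂ} {R : ℝ} (hw : w ∈ ball c R)
    (hφ : HarmonicOnNhd φ (closedBall c R)) : PI φ c R w = φ w :=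
  hφ.circleAverage_poissonKernel_smul hw

lemma PI_harmonicOn {φ : ℂ → ℝ} {c : ℂ} {R : ℝ} (hR : 0 < R)
    (hφ : ContinuousOn φ (sphere c R)) : HarmonicOnNhd (PI φ c R) (ball c R) := by
  have hR' : |R| = R := abs_of_pos hR
  have hci : CircleIntegrable (fun z => φ (z + c)) 0 R := by
    apply ContinuousOn.circleIntegrable'
    rw [hR']
    apply hφ.comp (by fun_prop)
    intro z hz
    simpa [dist_eq_norm] using hz
  have hci' : CircleIntegrable (fun z => ((φ (z + c) : ℝ) : ℂ)) 0 R := by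
    apply ContinuousOn.circleIntegrable'
    rw [hR']
    apply Complex.continuous_ofReal.comp_continuousOn
    apply hφ.comp (by fun_prop)
    intro z hz
    simpa [dist_eq_norm] using hz
  have han := analyticOnNhd_circleAverage_herglotzRieszKernel_smul hci'
  intro w hw
  have hw' : w - c ∈ ball (0 : ℂ) R := by simpa [dist_eq_norm] using hw
  have h1 : HarmonicAt (fun w => (Real.circleAverage (fun ζ => herglotzRieszKernel 0 (w - c) ζ •
      ((φ (ζ + c) : ℝ) : ℂ)) 0 R).re) w := by
    apply AnalyticAt.harmonicAt_re
    exact (han (w - c) hw').fun_comp (f := fun w => w - c) (by fun_prop)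
  refine (harmonicAt_congr_nhds ?_).1 h1
  filter_upwards [isOpen_ball.mem_nhds hw] with x hx
  have hx' : x - c ∈ ball (0 : ℂ) R := by simpa [dist_eq_norm] using hx
  rw [re_circleAverage_herglotzRieszKernel_smul hci hx', PI,
    ← Real.circleAverage_map_add_const (c := c)]
  congr 1
  ext z
  simp [poissonKernel_eq_re_herglotzRieszKernel, herglotzRieszKernel_add_const]

lemma PI_tendsto {φ : ℂ → ℝ} {c ζ₀ : ℂ} {R : ℝ} (hR : 0 < R)
    (hφ : ContinuousOn φ (sphere c R)) (hζ : ζ₀ ∈ sphere c R) :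
    Tendsto (PI φ c R) (𝓝[ball c R] ζ₀) (𝓝 (φ ζ₀)) := by
  obtain ⟨M, hM⟩ := (isCompact_sphere c R).exists_bound_of_continuousOn hφ
  set A : ℂ → ℝ := fun z => 2 * R ^ 2 - 2 * ((z - c) * (starRingEnd ℂ) (ζ₀ - c)).re with hA
  have hζ' : ‖ζ₀ - c‖ = R := by simpa [dist_eq_norm] using hζ
  have hAc : Continuous A := by fun_prop
  have hA0 : A ζ₀ = 0 := by
    simp only [hA, Complex.mul_conj, Complex.ofReal_re, Complex.normSq_eq_norm_sq, hζ']
    ring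
  have hAs : ∀ z ∈ sphere c R, A z = ‖z - ζ₀‖ ^ 2 := by
    intro z hz
    have hz' : ‖z - c‖ = R := by simpa [dist_eq_norm] using hz
    have : z - ζ₀ = (z - c) - (ζ₀ - c) := by ring
    rw [this, ← Complex.normSq_eq_norm_sq, Complex.normSq_sub, Complex.normSq_eq_norm_sq,
      Complex.normSq_eq_norm_sq, hz', hζ']
    simp only [hA]; ring
  have hAh : ∀ a b : ℝ, ∀ s, HarmonicOnNhd (fun z => a + b * A z) s := by
    intro a b s z _
    have : (fun z => a + b * A z) = fun z : ℂ => ((a : ℂ) + b * (2 * R ^ 2 - 2 *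
      ((z - c) * (starRingEnd ℂ) (ζ₀ - c)))).re := by
      ext z
      have : ((a : ℂ) + b * (2 * R ^ 2 - 2 * ((z - c) * (starRingEnd ℂ) (ζ₀ - c)))) =
        ((a + b * (2 * R^2) : ℝ) : ℂ) - ((2 * b : ℝ) : ℂ) * ((z - c) * (starRingEnd ℂ) (ζ₀ - c)) := by
        push_cast; ring
      rw [this, Complex.sub_re, Complex.re_ofReal_mul, Complex.ofReal_re]
      simp only [hA]; ring
    rw [this]
    apply AnalyticAt.harmonicAt_re
    fun_prop
  rw [Metric.tendsto_nhds]
  intro ε hε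
  obtain ⟨δ, hδ, hδ'⟩ := Metric.continuousOn_iff.1 hφ ζ₀ hζ (ε / 2) (by positivity)
  have hM0 : 0 ≤ M := le_trans (norm_nonneg _) (hM ζ₀ hζ)
  set C : ℝ := 2 * M / δ ^ 2 with hC
  have hC0 : 0 ≤ C := by positivity
  have key : ∀ z ∈ sphere c R, |φ z - φ ζ₀| ≤ ε / 2 + C * A z := by
    intro z hz
    rw [hAs z hz]
    by_cases hd : dist z ζ₀ < δ
    · have := hδ' z hz hd
      rw [Real.dist_eq] at this
      have h2 : 0 ≤ C * ‖z - ζ₀‖ ^ 2 := by positivity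
      linarith
    · push Not at hd
      rw [dist_eq_norm] at hd
      have h1 := hM z hz
      have h2 := hM ζ₀ hζ
      have h3 : |φ z - φ ζ₀| ≤ 2 * M := by
        have := norm_sub_le (φ z) (φ ζ₀)
        rw [Real.norm_eq_abs] at this
        linarith
      have h4 : δ ^ 2 ≤ ‖z - ζ₀‖ ^ 2 := by gcongr
      have h5 : C * δ ^ 2 = 2 * M := by rw [hC]; field_simp
      have h6 : C * δ ^ 2 ≤ C * ‖z - ζ₀‖ ^ 2 := by gcongr
      linarith
  have hlim : ∀ᶠ w in 𝓝 ζ₀, C * A w < ε / 2 := by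
    have : ContinuousAt (fun w => C * A w) ζ₀ := by fun_prop
    apply this.eventually_lt continuousAt_const
    simp [hA0]; positivity
  filter_upwards [nhdsWithin_le_nhds hlim, self_mem_nhdsWithin] with w hw hwb
  have hsc := sphere_subset_closedBall (x := c) (ε := R)
  have up : PI φ c R w ≤ (φ ζ₀ + ε / 2) + C * A w := by
    rw [← PI_harm hwb (hAh (φ ζ₀ + ε / 2) C _)]
    apply PI_mono hwb hφ (by fun_prop)
    intro z hz
    have := (abs_le.1 (key z hz)).2
    linarith
  have lo : (φ ζ₀ - ε / 2) + (-C) * A w ≤ PI φ c R w := by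
    rw [← PI_harm hwb (hAh (φ ζ₀ - ε / 2) (-C) _)]
    apply PI_mono hwb (by fun_prop) hφ
    intro z hz
    have := (abs_le.1 (key z hz)).1
    linarith
  rw [Real.dist_eq, abs_lt]
  constructor <;> linarith

/-- Harnack's inequality. -/
lemma harnack {h : ℂ → ℝ} {c w : ℂ} {R : ℝ} (hw : w ∈ ball c R)
    (hh : HarmonicOnNhd h (closedBall c R)) (hp : ∀ z ∈ closedBall c R, 0 ≤ h z) :
    h w ≤ (R + ‖w - c‖) / (R - ‖w - c‖) * h c ∧ h c ≤ (R + ‖w - c‖) / (R - ‖w - c‖) * h w := by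
  have hR : 0 < R := pos_of_mem_ball hw
  have hR' : |R| = R := abs_of_pos hR
  have h1 : ‖w - c‖ < R := by simpa [dist_eq_norm] using hw
  have hk := pk_cont hw
  have hc : ContinuousOn h (sphere c R) := hh.continuousOn.mono sphere_subset_closedBall
  have hav : Real.circleAverage h c R = h c := InnerProductSpace.HarmonicOnNhd.circleAverage_eq (by rwa [hR'])
  have i1 : CircleIntegrable (poissonKernel c w • h) c R :=
    ContinuousOn.circleIntegrable' (by rw [hR'] at hk ⊢; exact hk.mul hc)
  have i2 : ∀ a : ℝ, CircleIntegrable (a • h) c R := fun a =>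
    ContinuousOn.circleIntegrable' (by rw [hR']; exact hc.const_smul a)
  have hpi := PI_harm hw hh
  unfold PI at hpi
  constructor
  · rw [← hav, ← smul_eq_mul, ← Real.circleAverage_smul, ← hpi]
    apply Real.circleAverage_mono i1 (i2 _)
    intro z hz
    rw [hR'] at hz
    exact mul_le_mul_of_nonneg_right (pk_le hw hz) (hp z (sphere_subset_closedBall hz))
  · have : (R - ‖w - c‖) / (R + ‖w - c‖) * h c ≤ h w := by
      rw [← hav, ← smul_eq_mul, ← Real.circleAverage_smul, ← hpi]
      apply Real.circleAverage_mono (i2 _) i1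
      intro z hz
      rw [hR'] at hz
      exact mul_le_mul_of_nonneg_right (pk_ge hw hz) (hp z (sphere_subset_closedBall hz))
    have hn := norm_nonneg (w - c)
    have a1 : 0 < R - ‖w - c‖ := by linarith
    have a2 : 0 < R + ‖w - c‖ := by linarith
    calc h c = (R + ‖w - c‖) / (R - ‖w - c‖) * ((R - ‖w - c‖) / (R + ‖w - c‖) * h c) := by
          field_simp
      _ ≤ _ := by gcongr

def SubMeanAt (v : ℂ → ℝ) (z : ℂ) : Prop :=
  ∀ᶠ r in 𝓝[>] (0 : ℝ), v z ≤ Real.circleAverage v z r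

lemma ev_closedBall {z : ℂ} {U : Set ℂ} (hU : U ∈ 𝓝 z) :
    ∀ᶠ r in 𝓝[>] (0 : ℝ), closedBall z r ⊆ U ∧ 0 < r := by
  obtain ⟨ε, hε, h⟩ := Metric.mem_nhds_iff.1 hU
  filter_upwards [Ioo_mem_nhdsGT hε] with r hr
  exact ⟨(closedBall_subset_ball hr.2).trans h, hr.1⟩

lemma harm_mean {h : ℂ → ℝ} {z : ℂ} (hh : HarmonicAt h z) :
    ∀ᶠ r in 𝓝[>] (0 : ℝ), Real.circleAverage h z r = h z := by
  filter_upwards [ev_closedBall ((isOpen_setOfPred_harmonicAt h).mem_nhds hh)] with r hr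
  apply InnerProductSpace.HarmonicOnNhd.circleAverage_eq
  rw [abs_of_pos hr.2]
  exact fun x hx => hr.1 hx

lemma avg_normSq (z : ℂ) {r : ℝ} (hr : 0 < r) :
    Real.circleAverage (fun x => ‖x‖ ^ 2) z r = ‖z‖ ^ 2 + r ^ 2 := by
  set q : ℂ → ℝ := fun x => ‖z‖ ^ 2 + r ^ 2 + 2 * ((x - z) * (starRingEnd ℂ) z).re with hq
  have h1 : Real.circleAverage (fun x => ‖x‖ ^ 2) z r = Real.circleAverage q z r := by
    apply Real.circleAverage_congr_sphere
    intro x hx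
    rw [abs_of_pos hr] at hx
    have hx' : ‖x - z‖ = r := by simpa [dist_eq_norm] using hx
    have : x = (x - z) + z := by ring
    simp only [hq]
    conv_lhs => rw [this]
    rw [← Complex.normSq_eq_norm_sq, Complex.normSq_add, Complex.normSq_eq_norm_sq,
      Complex.normSq_eq_norm_sq, hx']
    ring
  rw [h1, InnerProductSpace.HarmonicOnNhd.circleAverage_eq]
  · simp [hq]
  · intro x _
    have : q = fun x : ℂ => (((‖z‖ ^ 2 + r ^ 2 : ℝ) : ℂ) + ((2 : ℝ) : ℂ) *
        ((x - z) * (starRingEnd ℂ) z)).re := by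
      ext x
      rw [Complex.add_re, Complex.re_ofReal_mul, Complex.ofReal_re]
    rw [this]
    apply AnalyticAt.harmonicAt_re
    fun_prop

/-- Maximum principle. -/
lemma max_principle {Ω : Set ℂ} (hΩ : IsOpen Ω) (hb : Bornology.IsBounded Ω) {w : ℂ → ℝ}
    (hw : ContinuousOn w Ω) (hs : ∀ z ∈ Ω, SubMeanAt w z)
    (hbd : ∀ ζ, ζ ∉ Ω → ζ ∈ closure Ω → ∀ δ > 0, ∀ᶠ z in 𝓝[Ω] ζ, w z < δ) :
    ∀ z ∈ Ω, w z ≤ 0 := by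
  intro z0 hz0
  by_contra hcon
  push Not at hcon
  set δ := w z0 / 2 with hδ
  have hδ0 : 0 < δ := by positivity
  set K : Set ℂ := {z ∈ Ω | δ ≤ w z} with hK
  have hKΩ : K ⊆ Ω := fun z hz => hz.1
  have hKcl : IsClosed K := by
    rw [← closure_subset_iff_isClosed]
    intro ζ hζ
    have hfr : ∃ᶠ z in 𝓝 ζ, z ∈ K := mem_closure_iff_frequently.1 hζ
    by_cases hζΩ : ζ ∈ Ω
    · refine ⟨hζΩ, ?_⟩
      by_contra hlt
      push Not at hlt
      have := ((hw.continuousAt (hΩ.mem_nhds hζΩ)).eventually_lt continuousAt_const hlt)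
      obtain ⟨z, h1, h2⟩ := (hfr.and_eventually this).exists
      exact absurd h1.2 (not_le.2 h2)
    · exfalso
      have := hbd ζ hζΩ (closure_mono hKΩ hζ) δ hδ0
      rw [eventually_nhdsWithin_iff] at this
      obtain ⟨z, h1, h2⟩ := (hfr.and_eventually this).exists
      exact absurd h1.2 (not_le.2 (h2 h1.1))
  have hKc : IsCompact K := Metric.isCompact_of_isClosed_isBounded hKcl (hb.subset hKΩ)
  obtain ⟨R, hR⟩ := hb.exists_norm_le
  set ε := δ / (R ^ 2 + 1) with hε
  have hε0 : 0 < ε := by positivity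
  have hεR : ε * R ^ 2 < δ := by
    rw [hε, div_mul_eq_mul_div, div_lt_iff₀ (by positivity)]
    nlinarith
  set g : ℂ → ℝ := fun z => w z + ε * ‖z‖ ^ 2 with hg
  have hz0K : z0 ∈ K := ⟨hz0, by rw [hδ]; linarith⟩
  have hgc : ContinuousOn g Ω := hw.add (by fun_prop)
  obtain ⟨z1, hz1, hmax⟩ := hKc.exists_isMaxOn ⟨z0, hz0K⟩ (hgc.mono hKΩ)
  have hgm : ∀ z ∈ Ω, g z ≤ g z1 := by
    intro z hz
    by_cases hzK : z ∈ K
    · exact hmax hzK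
    · have h1 : w z < δ := by
        by_contra h; push Not at h; exact hzK ⟨hz, h⟩
      have h2 : g z0 ≤ g z1 := hmax hz0K
      have h3 : ‖z‖ ^ 2 ≤ R ^ 2 := by have := hR z hz; gcongr
      have h4 : ε * ‖z‖ ^ 2 ≤ ε * R ^ 2 := by gcongr
      have h5 : 0 ≤ ε * ‖z0‖ ^ 2 := by positivity
      simp only [hg] at h2 ⊢
      linarith
  obtain ⟨r, h1, h2, hr⟩ := ((hs z1 hz1.1).and (ev_closedBall (hΩ.mem_nhds hz1.1))).exists
  have hsp : sphere z1 |r| ⊆ Ω := by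
    rw [abs_of_pos hr]; exact sphere_subset_closedBall.trans h2
  have hle : Real.circleAverage g z1 r ≤ g z1 :=
    Real.circleAverage_mono_on_of_le_circle (hgc.mono hsp).circleIntegrable'
      (fun x hx => hgm x (hsp hx))
  have heq : Real.circleAverage g z1 r = Real.circleAverage w z1 r +
      ε * (‖z1‖ ^ 2 + r ^ 2) := by
    rw [← avg_normSq z1 hr, hg, Real.circleAverage_fun_add (hw.mono hsp).circleIntegrable'
      (ContinuousOn.circleIntegrable' (by fun_prop))]
    congr 1
    exact Real.circleAverage_fun_smul (a := ε) (f := fun x : ℂ => ‖x‖ ^ 2)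
  have : 0 < ε * r ^ 2 := by positivity
  simp only [hg] at hle heq
  rw [heq] at hle
  linarith

lemma SubMeanAt.sub_harm {v h : ℂ → ℝ} {z : ℂ} (hv : SubMeanAt v z) (hh : HarmonicAt h z)
    (hvc : ∀ᶠ x in 𝓝 z, ContinuousAt v x) : SubMeanAt (fun x => v x - h x) z := by
  have hN : {x | ContinuousAt v x ∧ HarmonicAt h x} ∈ 𝓝 z := hvc.and hh.eventually
  filter_upwards [hv, harm_mean hh, ev_closedBall hN] with r h1 h2 h3
  have hs : sphere z |r| ⊆ {x | ContinuousAt v x ∧ HarmonicAt h x} := by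
    rw [abs_of_pos h3.2]; exact sphere_subset_closedBall.trans h3.1
  rw [Real.circleAverage_fun_sub, h2]
  · linarith
  · exact ContinuousOn.circleIntegrable' fun x hx => (hs hx).1.continuousWithinAt
  · exact ContinuousOn.circleIntegrable' fun x hx => (hs hx).2.1.continuousAt.continuousWithinAt

lemma SubMeanAt.of_le {v w : ℂ → ℝ} {z : ℂ} (hv : SubMeanAt v z) (hvc : Continuous v)
    (hwc : Continuous w) (h : ∀ᶠ x in 𝓝 z, v x ≤ w x) (he : w z ≤ v z) : SubMeanAt w z := by
  filter_upwards [hv, ev_closedBall h] with r h1 h2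
  refine he.trans (h1.trans ?_)
  apply Real.circleAverage_mono hvc.continuousOn.circleIntegrable'
    hwc.continuousOn.circleIntegrable'
  intro x hx
  rw [abs_of_pos h2.2] at hx
  exact h2.1 (sphere_subset_closedBall hx)

open Classical in
noncomputable def pmod (v : ℂ → ℝ) (c : ℂ) (R : ℝ) (z : ℂ) : ℝ :=
  if z ∈ ball c R then PI v c R z else v z

lemma pmod_in {v : ℂ → ℝ} {c z : ℂ} {R : ℝ} (hz : z ∈ ball c R) : pmod v c R z = PI v c R z := by
  simp only [pmod, if_pos hz]

lemma pmod_out {v : ℂ → ℝ} {c z : ℂ} {R : ℝ} (hz : z ∉ ball c R) : pmod v c R z = v z := by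
  simp only [pmod, if_neg hz]

lemma pmod_harm {v : ℂ → ℝ} {c : ℂ} {R : ℝ} (hR : 0 < R) (hv : Continuous v) :
    HarmonicOnNhd (pmod v c R) (ball c R) := by
  intro z hz
  refine (harmonicAt_congr_nhds ?_).1 (PI_harmonicOn hR hv.continuousOn z hz)
  filter_upwards [isOpen_ball.mem_nhds hz] with x hx
  rw [pmod_in hx]

lemma pmod_cont {v : ℂ → ℝ} {c : ℂ} {R : ℝ} (hR : 0 < R) (hv : Continuous v) :
    Continuous (pmod v c R) := by
  rw [continuous_iff_continuousAt]
  intro z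
  by_cases hz : z ∈ ball c R
  · exact (pmod_harm hR hv z hz).1.continuousAt
  · unfold ContinuousAt
    rw [pmod_out hz, ← nhdsWithin_univ, ← Set.union_compl_self (ball c R), nhdsWithin_union,
      tendsto_sup]
    constructor
    · by_cases hz' : z ∈ sphere c R
      · refine (PI_tendsto hR hv.continuousOn hz').congr' ?_
        filter_upwards [self_mem_nhdsWithin] with x hx
        rw [pmod_in hx]
      · have : 𝓝[ball c R] z = ⊥ := by
          rw [← notMem_closure_iff_nhdsWithin_eq_bot, closure_ball c hR.ne']
          intro h
          simp only [mem_ball, mem_sphere, mem_closedBall] at *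
          exact hz' (le_antisymm h (not_lt.1 hz))
        rw [this]; exact tendsto_bot
    · refine (hv.continuousAt.continuousWithinAt (s := (ball c R)ᶜ)).tendsto.congr' ?_
      filter_upwards [self_mem_nhdsWithin] with x hx
      rw [pmod_out hx]

lemma le_pmod {v : ℂ → ℝ} {c : ℂ} {R : ℝ} (hR : 0 < R) (hv : Continuous v)
    (hs : ∀ z ∈ ball c R, SubMeanAt v z) (z : ℂ) : v z ≤ pmod v c R z := by
  by_cases hz : z ∈ ball c R
  · have hc := hv.sub (pmod_cont (c := c) hR hv)
    have := max_principle isOpen_ball isBounded_ball (Ω := ball c R)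
      (w := fun x => v x - pmod v c R x) hc.continuousOn
      (fun x hx => (hs x hx).sub_harm (pmod_harm hR hv x hx)
        (Eventually.of_forall fun x => hv.continuousAt))
      (by
        intro ζ hζ _ δ hδ
        apply nhdsWithin_le_nhds
        apply hc.continuousAt.eventually_lt continuousAt_const
        simpa [pmod_out hζ] using hδ) z hz
    linarith
  · rw [pmod_out hz]

lemma pmod_subMean {v : ℂ → ℝ} {c : ℂ} {R : ℝ} (hR : 0 < R) (hv : Continuous v)
    (hs : ∀ z ∈ ball c R, SubMeanAt v z) {z : ℂ} (hz : SubMeanAt v z) :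
    SubMeanAt (pmod v c R) z := by
  by_cases hzb : z ∈ ball c R
  · exact (harm_mean (pmod_harm hR hv z hzb)).mono fun r h => h.ge
  · exact hz.of_le hv (pmod_cont hR hv) (Eventually.of_forall (le_pmod hR hv hs))
      (pmod_out hzb).le

lemma harmonicOn_iff {h : ℂ → ℝ} {U : Set ℂ} (hU : IsOpen U) :
    HarmonicOn h U ↔ HarmonicOnNhd h U := by
  have key : ∀ z ∈ U, iteratedFDerivWithin ℝ 2 h U z ![1, 1] +
      iteratedFDerivWithin ℝ 2 h U z ![Complex.I, Complex.I] = Laplacian.laplacian h z := by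
    intro z hz
    rw [laplacian_eq_iteratedFDeriv_complexPlane, iteratedFDerivWithin_of_isOpen 2 hU hz]
  constructor
  · rintro ⟨h1, h2⟩ z hz
    refine ⟨h1.contDiffAt (hU.mem_nhds hz), ?_⟩
    filter_upwards [hU.mem_nhds hz] with x hx
    rw [← key x hx, h2 x hx]; rfl
  · intro hh
    refine ⟨hh.contDiffOn, fun z hz => ?_⟩
    rw [key z hz]
    exact (hh z hz).2.self_of_nhds

lemma harmonicAt_conj {h : ℂ → ℝ} {z : ℂ} (hh : HarmonicAt h (starRingEnd ℂ z)) :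
    HarmonicAt (fun x => h (starRingEnd ℂ x)) z := by
  obtain ⟨ε, hε, hb⟩ := Metric.mem_nhds_iff.1 ((isOpen_setOfPred_harmonicAt h).mem_nhds hh)
  obtain ⟨F, hF, hre⟩ := HarmonicOnNhd.exists_analyticOnNhd_ball_re_eq (f := h)
    (z := starRingEnd ℂ z) (R := ε) (fun x hx => hb hx)
  have hmem : ∀ x, x ∈ ball z ε → starRingEnd ℂ x ∈ ball (starRingEnd ℂ z) ε := by
    intro x hx
    simpa [Complex.dist_conj_conj] using hx
  have han : AnalyticAt ℂ (fun x => starRingEnd ℂ (F (starRingEnd ℂ x))) z := by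
    apply DifferentiableOn.analyticAt (s := ball z ε) _ (ball_mem_nhds z hε)
    intro x hx
    have := (hF _ (hmem x hx)).differentiableAt
    have := this.conj_conj
    simp only [Complex.conj_conj] at this
    exact this.differentiableWithinAt
  refine (harmonicAt_congr_nhds ?_).1 han.harmonicAt_re
  filter_upwards [ball_mem_nhds z hε] with x hx
  have := hre (hmem x hx)
  simpa using this

lemma ratio_le {R d k : ℝ} (h : R + d ≤ k * (R - d)) (hd : d < R) : (R + d) / (R - d) ≤ k := by
  rwa [div_le_iff₀ (by linarith)]

lemma hp_vert {H : ℂ → ℝ} (hH : HarmonicOnNhd H {z | 0 < z.im})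
    (hp : ∀ z : ℂ, 0 < z.im → 0 ≤ H z) {x y T : ℝ} (hy : 0 < y) (hT : y ≤ T) :
    H ⟨x, y⟩ ≤ 4 * T / y * H ⟨x, T⟩ ∧ H ⟨x, T⟩ ≤ 4 * T / y * H ⟨x, y⟩ := by
  have hn : ‖(⟨x, y⟩ : ℂ) - ⟨x, T⟩‖ = T - y := by
    have : (⟨x, y⟩ : ℂ) - ⟨x, T⟩ = ((y - T : ℝ) : ℂ) * Complex.I := by
      apply Complex.ext <;> simp
    rw [this, norm_mul, Complex.norm_I, mul_one, Complex.norm_real, Real.norm_eq_abs,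
      abs_of_nonpos (by linarith)]
    ring
  have hsub : ∀ z ∈ closedBall (⟨x, T⟩ : ℂ) (T - y / 2), 0 < z.im := by
    intro z hz
    rw [mem_closedBall, dist_eq_norm] at hz
    have := (Complex.abs_im_le_norm (z - ⟨x, T⟩)).trans hz
    have := (abs_le.1 this).1
    simp at this
    linarith
  have hw : (⟨x, y⟩ : ℂ) ∈ ball (⟨x, T⟩ : ℂ) (T - y / 2) := by
    rw [mem_ball, dist_eq_norm, hn]; linarith
  obtain ⟨h1, h2⟩ := harnack hw (fun z hz => hH z (hsub z hz)) (fun z hz => hp z (hsub z hz))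
  rw [hn] at h1 h2
  have hr : (T - y / 2 + (T - y)) / (T - y / 2 - (T - y)) ≤ 4 * T / y := by
    apply ratio_le _ (by linarith)
    have : 4 * T / y * (T - y / 2 - (T - y)) = 2 * T := by field_simp; ring
    linarith
  exact ⟨h1.trans (mul_le_mul_of_nonneg_right hr (hp _ (by simpa using hy.trans_le hT))),
    h2.trans (mul_le_mul_of_nonneg_right hr (hp _ (by simpa using hy)))⟩

lemma hp_horiz {H : ℂ → ℝ} (hH : HarmonicOnNhd H {z | 0 < z.im})
    (hp : ∀ z : ℂ, 0 < z.im → 0 ≤ H z) {x₁ x₂ T : ℝ} (hT : 0 < T) (hx : |x₁ - x₂| ≤ T / 2) :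
    H ⟨x₁, T⟩ ≤ 5 * H ⟨x₂, T⟩ := by
  have hn : ‖(⟨x₁, T⟩ : ℂ) - ⟨x₂, T⟩‖ = |x₁ - x₂| := by
    have : (⟨x₁, T⟩ : ℂ) - ⟨x₂, T⟩ = ((x₁ - x₂ : ℝ) : ℂ) := by
      apply Complex.ext <;> simp
    rw [this, Complex.norm_real, Real.norm_eq_abs]
  have hsub : ∀ z ∈ closedBall (⟨x₂, T⟩ : ℂ) (3 * T / 4), 0 < z.im := by
    intro z hz
    rw [mem_closedBall, dist_eq_norm] at hz
    have := (Complex.abs_im_le_norm (z - ⟨x₂, T⟩)).trans hz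
    have := (abs_le.1 this).1
    simp at this
    linarith
  have hw : (⟨x₁, T⟩ : ℂ) ∈ ball (⟨x₂, T⟩ : ℂ) (3 * T / 4) := by
    rw [mem_ball, dist_eq_norm, hn]; linarith
  obtain ⟨h1, -⟩ := harnack hw (fun z hz => hH z (hsub z hz)) (fun z hz => hp z (hsub z hz))
  rw [hn] at h1
  refine h1.trans (mul_le_mul_of_nonneg_right ?_ (hp _ (by simpa using hT)))
  apply ratio_le <;> linarith

lemma hp_dichotomy {H : ℂ → ℝ} (hH : HarmonicOnNhd H {z | 0 < z.im})
    (hp : ∀ z : ℂ, 0 < z.im → 0 ≤ H z) :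
    (∃ κ > 0, ∀ z : ℂ, 0 < z.im → κ * z.im ≤ H z) ∨
    (∀ ε > 0, ∃ T₀ > 0, ∀ z : ℂ, |z.re| ≤ z.im → T₀ ≤ z.im → H z ≤ ε * z.im) := by
  by_cases hk : ∃ κ > 0, ∀ z : ℂ, 0 < z.im → κ * z.im ≤ H z
  · exact Or.inl hk
  right
  push Not at hk
  intro ε hε
  obtain ⟨⟨x0, y0⟩, hz0, hlt⟩ := hk (ε / 1600) (by positivity)
  simp only at hz0 hlt
  refine ⟨max y0 (2 * |x0|), lt_max_of_lt_left hz0, ?_⟩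
  rintro ⟨x, y⟩ hxy hy
  simp only at hxy hy ⊢
  have hy1 : y0 ≤ y := (le_max_left _ _).trans hy
  have hy2 : 2 * |x0| ≤ y := (le_max_right _ _).trans hy
  have hypos : 0 < y := hz0.trans_le hy1
  have a1 := (hp_vert hH hp (x := x) hypos (show y ≤ 2 * y by linarith)).1
  have a2 := hp_horiz hH hp (x₁ := x) (x₂ := 0) (T := 2 * y) (by linarith)
    (by rw [sub_zero]; linarith)
  have a3 := hp_horiz hH hp (x₁ := 0) (x₂ := x0) (T := 2 * y) (by linarith)
    (by rw [zero_sub, abs_neg]; linarith [abs_nonneg x0])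
  have a4 := (hp_vert hH hp (x := x0) hz0 (show y0 ≤ 2 * y by linarith)).2
  have e1 : 4 * (2 * y) / y = 8 := by field_simp; norm_num
  rw [e1] at a1
  have a5 : 4 * (2 * y) / y0 * H ⟨x0, y0⟩ ≤ 4 * (2 * y) / y0 * (ε / 1600 * y0) := by
    gcongr
  have e2 : 4 * (2 * y) / y0 * (ε / 1600 * y0) = ε * y / 200 := by field_simp; norm_num
  rw [e2] at a5
  linarith

lemma sector_bound {f : ℂ → ℂ} (hf : Differentiable ℂ f) {A B : ℝ}
    (hg : ∀ z, Real.log ‖f z‖ ≤ A * ‖z‖ + B) {C ε : ℝ} (hε : 0 < ε) (hC : 0 < C)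
    (hb : ∀ z : ℂ, |z.re| = |z.im| → ‖f z‖ ≤ C * Real.exp (ε * ‖z‖)) :
    ∀ z : ℂ, |z.im| ≤ z.re → ‖f z‖ ≤ C * Real.exp (2 * ε * ‖z‖) := by
  have hg' : ∀ z, ‖f z‖ ≤ Real.exp (A * ‖z‖ + B) := fun z =>
    (Real.le_exp_log _).trans (Real.exp_le_exp.2 (hg z))
  set G : ℂ → ℂ := fun q => f ((1 - Complex.I) * q) * Complex.exp (-(2 * ε : ℝ) * ((1 - Complex.I) * q))
    with hG
  have hGn : ∀ q, ‖G q‖ = ‖f ((1 - Complex.I) * q)‖ * Real.exp (-(2 * ε) * (q.re + q.im)) := by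
    intro q
    rw [hG]
    simp only [norm_mul, Complex.norm_exp]
    congr 2
    rw [← Complex.ofReal_neg, Complex.re_ofReal_mul]
    simp
  have hn : ‖(1 - Complex.I : ℂ)‖ ≤ 2 := by
    refine (norm_sub_le _ _).trans ?_
    simp; norm_num
  have hGd : Differentiable ℂ G := by
    apply Differentiable.mul
    · exact hf.comp (by fun_prop)
    · fun_prop
  have bd1 : ∀ q : ℂ, 0 ≤ q.re → 0 ≤ q.im →
      |((1 - Complex.I) * q).re| = |((1 - Complex.I) * q).im| → ‖G q‖ ≤ C := by
    intro q h1 h2 h3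
    rw [hGn]
    have := hb _ h3
    have hle : ‖(1 - Complex.I) * q‖ ≤ 2 * (q.re + q.im) := by
      rw [norm_mul]
      have : ‖q‖ ≤ q.re + q.im := by
        have := Complex.norm_le_abs_re_add_abs_im q
        rwa [abs_of_nonneg h1, abs_of_nonneg h2] at this
      have h0 := norm_nonneg q
      nlinarith
    calc _ ≤ C * Real.exp (ε * ‖(1 - Complex.I) * q‖) * Real.exp (-(2 * ε) * (q.re + q.im)) := by
          gcongr
      _ = C * Real.exp (ε * ‖(1 - Complex.I) * q‖ + -(2 * ε) * (q.re + q.im)) := by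
          rw [Real.exp_add]; ring
      _ ≤ C * 1 := by
          gcongr
          rw [Real.exp_le_one_iff]
          nlinarith
      _ = C := mul_one C
  have hGb : ∀ q : ℂ, 0 ≤ q.re → 0 ≤ q.im → ‖G q‖ ≤ C := by
    intro q h1 h2
    refine PhragmenLindelof.quadrant_I hGd.diffContOnCl ?_ ?_ ?_ h1 h2
    · refine ⟨1, by norm_num, 2 * |A|, ?_⟩
      refine Asymptotics.IsBigO.of_bound (Real.exp B) ?_
      refine Filter.Eventually.filter_mono inf_le_right ?_
      rw [Filter.eventually_principal]
      intro q hq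
      have h1 : 0 < q.re := hq.1
      have h2 : 0 < q.im := hq.2
      rw [hGn, Real.rpow_one, Real.norm_eq_abs, Real.abs_exp, ← Real.exp_add]
      have e1 : Real.exp (-(2 * ε) * (q.re + q.im)) ≤ 1 := by
        rw [Real.exp_le_one_iff]
        have : 0 ≤ ε * (q.re + q.im) := by positivity
        linarith
      have e2 : A * ‖(1 - Complex.I) * q‖ ≤ 2 * |A| * ‖q‖ := by
        rw [norm_mul]
        calc A * (‖1 - Complex.I‖ * ‖q‖) ≤ |A| * (‖1 - Complex.I‖ * ‖q‖) := by
              gcongr; exact le_abs_self A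
          _ ≤ |A| * (2 * ‖q‖) := by gcongr
          _ = _ := by ring
      calc _ ≤ Real.exp (A * ‖(1 - Complex.I) * q‖ + B) * 1 := by
            gcongr; exact hg' _
        _ ≤ _ := by
            rw [mul_one]; apply Real.exp_le_exp.2; linarith
    · intro x hx
      apply bd1 _ (by simpa using hx) (by simp)
      simp
    · intro x hx
      apply bd1 _ (by simp) (by simpa using hx)
      simp
  intro z hz
  set q : ℂ := (1 + Complex.I) / 2 * z with hq
  have hqz : (1 - Complex.I) * q = z := by
    rw [hq]
    have : (1 - Complex.I) * (1 + Complex.I) = 2 := by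
      ring_nf; rw [Complex.I_sq]; norm_num
    linear_combination z / 2 * this
  have hqre : q.re = (z.re - z.im) / 2 := by
    rw [hq]; simp; ring
  have hqim : q.im = (z.re + z.im) / 2 := by
    rw [hq]; simp; ring
  have hab := abs_le.1 hz
  have := hGb q (by rw [hqre]; linarith) (by rw [hqim]; linarith)
  rw [hGn, hqz, hqre, hqim] at this
  have e : (z.re - z.im) / 2 + (z.re + z.im) / 2 = z.re := by ring
  rw [e] at this
  have hre : z.re ≤ ‖z‖ := Complex.re_le_norm z
  calc ‖f z‖ = ‖f z‖ * Real.exp (-(2 * ε) * z.re) * Real.exp (2 * ε * z.re) := by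
        rw [mul_assoc, ← Real.exp_add]; simp
    _ ≤ C * Real.exp (2 * ε * z.re) := by gcongr
    _ ≤ _ := by gcongr

lemma type_zero {f : ℂ → ℂ} (hf : Differentiable ℂ f) {A B : ℝ}
    (hg : ∀ z, Real.log ‖f z‖ ≤ A * ‖z‖ + B)
    (hc : ∀ ε > 0, ∃ T₀ > 0, ∀ z : ℂ, |z.re| ≤ |z.im| → T₀ ≤ |z.im| →
      Real.log ‖f z‖ ≤ ε * |z.im|) (ε : ℝ) (hε : 0 < ε) :
    ∃ C ≥ 1, ∀ z, ‖f z‖ ≤ C * Real.exp (2 * ε * ‖z‖) := by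
  obtain ⟨T₀, hT, hT'⟩ := hc ε hε
  obtain ⟨M, hM⟩ := (isCompact_closedBall (0 : ℂ) (2 * T₀)).exists_bound_of_continuousOn
    hf.continuous.continuousOn
  set C := max 1 M with hC
  have hC1 : 1 ≤ C := le_max_left _ _
  have hcone : ∀ z : ℂ, |z.re| ≤ |z.im| → ‖f z‖ ≤ C * Real.exp (ε * ‖z‖) := by
    intro z hz
    by_cases h : T₀ ≤ |z.im|
    · have h1 := hT' z hz h
      calc ‖f z‖ ≤ Real.exp (Real.log ‖f z‖) := Real.le_exp_log _
        _ ≤ Real.exp (ε * ‖z‖) := by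
          gcongr
          refine h1.trans ?_
          gcongr
          exact Complex.abs_im_le_norm z
        _ ≤ C * Real.exp (ε * ‖z‖) := le_mul_of_one_le_left (Real.exp_pos _).le hC1
    · push Not at h
      have h1 : z ∈ closedBall (0 : ℂ) (2 * T₀) := by
        rw [mem_closedBall_zero_iff]
        have := Complex.norm_le_abs_re_add_abs_im z
        linarith
      calc ‖f z‖ ≤ M := hM z h1
        _ ≤ C := le_max_right _ _
        _ ≤ C * Real.exp (ε * ‖z‖) := by
          apply le_mul_of_one_le_right (by linarith)
          rw [Real.one_le_exp_iff]; positivity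
  refine ⟨C, hC1, fun z => ?_⟩
  rcases le_total |z.re| |z.im| with h | h
  · refine (hcone z h).trans ?_
    have := norm_nonneg z
    gcongr
    linarith
  · rcases le_total 0 z.re with hr | hr
    · rw [abs_of_nonneg hr] at h
      exact sector_bound hf hg hε (by linarith) (fun z hz => hcone z hz.le) z h
    · rw [abs_of_nonpos hr] at h
      have := sector_bound (f := fun z => f (-z)) (hf.comp differentiable_neg) (A := A) (B := B)
        (fun z => by simpa using hg (-z)) hε (C := C) (by linarith)
        (fun z hz => by simpa using hcone (-z) (by simpa using hz.le)) (-z) (by simpa using h)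
      simpa using this

lemma type_contra {f : ℂ → ℂ}
    (hf_type : 0 < Filter.limsup (fun z : ℂ => Real.log ‖f z‖ / ‖z‖)
      (Filter.comap (fun z : ℂ => ‖z‖) Filter.atTop))
    (h : ∀ ε > 0, ∃ C ≥ 1, ∀ z, ‖f z‖ ≤ C * Real.exp (2 * ε * ‖z‖)) : False := by
  set L := Filter.limsup (fun z : ℂ => Real.log ‖f z‖ / ‖z‖)
      (Filter.comap (fun z : ℂ => ‖z‖) Filter.atTop) with hL
  rw [Filter.limsup_eq] at hL
  set S := {a | ∀ᶠ n : ℂ in Filter.comap (fun z : ℂ => ‖z‖) Filter.atTop,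
    Real.log ‖f n‖ / ‖n‖ ≤ a} with hS
  obtain ⟨C, hC1, hC⟩ := h (L / 6) (by positivity)
  have hmem : L / 2 ∈ S := by
    have : ∀ᶠ t : ℝ in atTop, Real.log C / (L / 6) ≤ t ∧ 0 < t :=
      (eventually_ge_atTop _).and (eventually_gt_atTop 0)
    refine (tendsto_comap.eventually this).mono ?_
    rintro z ⟨h1, h2⟩
    rw [div_le_iff₀ h2]
    rw [div_le_iff₀ (by positivity)] at h1
    have h3 : 0 ≤ Real.log C := Real.log_nonneg hC1
    by_cases hz : f z = 0
    · rw [hz]; simp; positivity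
    · have := Real.log_le_log (norm_pos_iff.2 hz) (hC z)
      rw [Real.log_mul (by positivity) (by positivity), Real.log_exp] at this
      linarith
  by_cases hbd : BddBelow S
  · have := csInf_le hbd hmem
    linarith
  · rw [Real.sInf_of_not_bddBelow hbd] at hL
    linarith

structure Fam (K : Set ℂ) (v : ℂ → ℝ) : Prop where
  cont : Continuous v
  sub : ∀ z ∉ K, SubMeanAt v z
  zero : ∀ z ∈ K, v z = 0
  ge : ∀ z, |z.im| ≤ v z
  out : ∃ R : ℝ, ∀ z, R ≤ ‖z‖ → v z = |z.im|

lemma HarmonicAt_sub {h : ℂ → ℝ} {z : ℂ} (hh : HarmonicAt h z) : SubMeanAt h z := by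
  filter_upwards [harm_mean hh] with r hr
  exact hr.ge

lemma harm_im (z : ℂ) : HarmonicAt (fun x : ℂ => x.im) z :=
  AnalyticAt.harmonicAt_im analyticAt_id

lemma harm_neg_im (z : ℂ) : HarmonicAt (fun x : ℂ => -x.im) z := by
  have : (fun x : ℂ => -x.im) = fun x : ℂ => (-x).im := by ext; simp
  rw [this]
  exact AnalyticAt.harmonicAt_im analyticAt_id.neg

lemma avg_refl (v : ℂ → ℝ) (c z : ℂ) (r : ℝ) :
    Real.circleAverage (fun x => v ((starRingEnd ℂ) x + c)) z r =
      Real.circleAverage v ((starRingEnd ℂ) z + c) r := by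
  unfold Real.circleAverage
  congr 1
  have h1 : ∀ θ : ℝ, (starRingEnd ℂ) (circleMap z r θ) + c
      = circleMap ((starRingEnd ℂ) z + c) r (-θ) := by
    intro θ
    simp only [circleMap, map_add, map_mul, Complex.conj_ofReal, ← Complex.exp_conj, Complex.conj_I]
    push_cast
    ring_nf
  simp only [h1]
  rw [intervalIntegral.integral_comp_neg (fun θ => v (circleMap ((starRingEnd ℂ) z + c) r θ))]
  have hp : Function.Periodic (fun θ => v (circleMap ((starRingEnd ℂ) z + c) r θ))
      (2 * Real.pi) := fun θ => by
    simp only [periodic_circleMap _ _ θ]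
  have := hp.intervalIntegral_add_eq (-(2 * Real.pi)) 0
  simpa using this

lemma SubMeanAt.refl_comp {v : ℂ → ℝ} {c z : ℂ} (h : SubMeanAt v ((starRingEnd ℂ) z + c)) :
    SubMeanAt (fun x => v ((starRingEnd ℂ) x + c)) z := by
  filter_upwards [h] with r hr
  rw [avg_refl]; exact hr

section fam
variable {K : Set ℂ} 

lemma fam_abs (hK : ∀ z ∈ K, z.im = 0) : Fam K (fun z => |z.im|) where
  cont := by fun_prop
  sub z _ := by
    rcases le_total 0 z.im with h | h
    · exact (HarmonicAt_sub (harm_im z)).of_le (by fun_prop) (by fun_prop)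
        (Eventually.of_forall fun x => le_abs_self _) (by rw [abs_of_nonneg h])
    · exact (HarmonicAt_sub (harm_neg_im z)).of_le (by fun_prop) (by fun_prop)
        (Eventually.of_forall fun x => neg_le_abs _) (by rw [abs_of_nonpos h])
  zero z hz := by simp [hK z hz]
  ge z := le_rfl
  out := ⟨0, fun _ _ => rfl⟩

lemma Fam.max {v w : ℂ → ℝ} (hv : Fam K v) (hw : Fam K w) : Fam K (fun z => max (v z) (w z)) where
  cont := hv.cont.max hw.cont
  sub z hz := by
    rcases le_total (v z) (w z) with h | h
    · exact (hw.sub z hz).of_le hw.cont (hv.cont.max hw.cont)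
        (Eventually.of_forall fun x => le_max_right _ _) (by simp [h])
    · exact (hv.sub z hz).of_le hv.cont (hv.cont.max hw.cont)
        (Eventually.of_forall fun x => le_max_left _ _) (by simp [h])
  zero z hz := by simp [hv.zero z hz, hw.zero z hz]
  ge z := (hv.ge z).trans (le_max_left _ _)
  out := by
    obtain ⟨R, hR⟩ := hv.out
    obtain ⟨S, hS⟩ := hw.out
    exact ⟨Max.max R S, fun z hz => by
      rw [hR z ((le_max_left _ _).trans hz), hS z ((le_max_right _ _).trans hz), max_self]⟩

lemma Fam.conj (hK : ∀ z ∈ K, z.im = 0) {v : ℂ → ℝ} (hv : Fam K v) :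
    Fam K (fun z => v ((starRingEnd ℂ) z)) where
  cont := hv.cont.comp Complex.continuous_conj
  sub z hz := by
    have : SubMeanAt v ((starRingEnd ℂ) z + 0) := by
      rw [add_zero]
      apply hv.sub
      intro h
      have h1 := hK _ h
      have : (starRingEnd ℂ) z = z := by
        apply Complex.ext <;> simp at h1 ⊢; simp [h1]
      exact hz (this ▸ h)
    simpa using this.refl_comp
  zero z hz := by
    have : (starRingEnd ℂ) z = z := Complex.conj_eq_iff_im.2 (hK z hz)
    rw [this]; exact hv.zero z hz
  ge z := by simpa using hv.ge ((starRingEnd ℂ) z)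
  out := by
    obtain ⟨R, hR⟩ := hv.out
    exact ⟨R, fun z hz => by rw [hR _ (by simpa using hz)]; simp⟩

lemma Fam.pmod {v : ℂ → ℝ} (hv : Fam K v) {c : ℂ} {R : ℝ} (hR : 0 < R)
    (hc : closedBall c R ⊆ Kᶜ) : Fam K (pmod v c R) := by
  have hb : ∀ z ∈ ball c R, SubMeanAt v z := fun z hz => hv.sub z (hc (ball_subset_closedBall hz))
  exact {
  cont := pmod_cont hR hv.cont
  sub := fun z hz => pmod_subMean hR hv.cont hb (hv.sub z hz)
  zero := fun z hz => by
    rw [pmod_out, hv.zero z hz]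
    exact fun h => hc (ball_subset_closedBall h) hz
  ge := fun z => (hv.ge z).trans (le_pmod hR hv.cont hb z)
  out := by
    obtain ⟨S, hS⟩ := hv.out
    refine ⟨Max.max S (‖c‖ + R), fun z hz => ?_⟩
    rw [pmod_out, hS z ((le_max_left _ _).trans hz)]
    intro h
    have h1 : ‖z - c‖ < R := by simpa [dist_eq_norm] using h
    have h2 : ‖z‖ ≤ ‖z - c‖ + ‖c‖ := by simpa using norm_add_le (z - c) c
    have := (le_max_right _ _).trans hz
    linarith }

open Classical in
noncomputable def Tr (s : ℝ) (v : ℂ → ℝ) (z : ℂ) : ℝ :=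
  if s ≤ z.im then max (v z) (v ((starRingEnd ℂ) z + (2 * s : ℝ) * I)) else v z

lemma Fam.tr (hK : ∀ z ∈ K, z.im = 0) {v : ℂ → ℝ} (hv : Fam K v) {s : ℝ} (hs : 0 < s) :
    Fam K (Tr s v) := by
  have hc0 : Continuous fun z : ℂ => v ((starRingEnd ℂ) z + (2 * s : ℝ) * I) :=
    hv.cont.comp (Complex.continuous_conj.add continuous_const)
  have hle : ∀ z, v z ≤ Tr s v z := fun z => by
    unfold Tr; split_ifs
    · exact le_max_left _ _
    · rfl
  have hc : Continuous (Tr s v) := by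
    unfold Tr
    apply Continuous.if_le (hv.cont.max hc0) hv.cont continuous_const Complex.continuous_im
    intro z hz
    have : (starRingEnd ℂ) z + (2 * s : ℝ) * I = z := by
      apply Complex.ext <;> simp [← hz]; ring
    rw [this, max_self]
  exact {
  cont := hc
  sub := fun z hz => by
    by_cases h : Tr s v z ≤ v z
    · exact (hv.sub z hz).of_le hv.cont hc (Eventually.of_forall hle) h
    · have h1 : s < z.im := by
        by_contra h2
        apply h
        rcases (not_lt.1 h2).lt_or_eq with h3 | h3
        · unfold Tr; rw [if_neg (not_le.2 h3)]
        · have : (starRingEnd ℂ) z + (2 * s : ℝ) * I = z := by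
            apply Complex.ext <;> simp [← h3]; ring
          unfold Tr; rw [this]; simp
      have h2 : Tr s v z = Max.max (v z) (v ((starRingEnd ℂ) z + (2 * s : ℝ) * I)) := by
        unfold Tr; rw [if_pos h1.le]
      have h3 : v z < v ((starRingEnd ℂ) z + (2 * s : ℝ) * I) := by
        by_contra h4
        rw [h2, max_eq_left (not_lt.1 h4)] at h
        exact h le_rfl
      have h4 : (starRingEnd ℂ) z + (2 * s : ℝ) * I ∉ K := fun h5 => by
        rw [hv.zero _ h5] at h3
        linarith [hv.ge z, abs_nonneg z.im]
      refine (hv.sub _ h4).refl_comp.of_le hc0 hc ?_ (by rw [h2, max_eq_right h3.le])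
      filter_upwards [(isOpen_lt continuous_const Complex.continuous_im).mem_nhds h1] with x hx
      unfold Tr
      rw [if_pos (le_of_lt hx)]
      exact le_max_right _ _
  zero := fun z hz => by
    unfold Tr
    rw [if_neg (by rw [hK z hz]; exact not_le.2 hs)]
    exact hv.zero z hz
  ge := fun z => (hv.ge z).trans (hle z)
  out := by
    obtain ⟨R, hR⟩ := hv.out
    refine ⟨Max.max R 0 + 2 * s, fun z hz => ?_⟩
    unfold Tr
    have hR0 := le_max_left R 0
    have hz1 : v z = |z.im| := hR z (by linarith)
    split_ifs with h
    · have h1 : ‖z‖ ≤ ‖(starRingEnd ℂ) z + (2 * s : ℝ) * I‖ + 2 * s := by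
        have := norm_sub_le ((starRingEnd ℂ) z + (2 * s : ℝ) * I) ((2 * s : ℝ) * I)
        rw [add_sub_cancel_right, RCLike.norm_conj, norm_mul, Complex.norm_real, norm_I, mul_one, Real.norm_eq_abs,
          abs_of_pos (by linarith : 0 < 2 * s)] at this
        exact this
      rw [hR ((starRingEnd ℂ) z + (2 * s : ℝ) * I) (by linarith), hz1, max_eq_left]
      have : ((starRingEnd ℂ) z + (2 * s : ℝ) * I).im = 2 * s - z.im := by simp; ring
      rw [this]
      rw [abs_of_pos (by linarith : 0 < z.im)]
      rw [abs_le]; constructor <;> linarith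
    · exact hz1 }

/-- comparison -/
lemma Fam.le_H (hKc : IsClosed K) {v : ℂ → ℝ} (hv : Fam K v) {H : ℂ → ℝ}
    (hH : HarmonicOnNhd H Kᶜ) (hHi : ∀ z ∉ K, |z.im| ≤ H z) :
    ∀ z ∉ K, v z ≤ H z := by
  intro z hz
  obtain ⟨R, hR⟩ := hv.out
  set S := Max.max R (‖z‖ + 1) with hS
  have hzS : z ∈ ball (0:ℂ) S := by
    have := le_max_right R (‖z‖ + 1)
    simp only [mem_ball, dist_zero_right]; linarith
  have hΩ : IsOpen (Kᶜ ∩ ball (0:ℂ) S) := hKc.isOpen_compl.inter isOpen_ball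
  have hHc : ∀ x ∉ K, ContinuousAt H x := fun x hx => (hH x hx).1.continuousAt
  have := max_principle (w := fun x => v x - H x) hΩ (isBounded_ball.subset inter_subset_right)
    (fun x hx => (hv.cont.continuousAt.sub (hHc x hx.1)).continuousWithinAt)
    (fun x hx => (hv.sub x hx.1).sub_harm (hH x hx.1)
      (Eventually.of_forall fun y => hv.cont.continuousAt)) ?_ z ⟨hz, hzS⟩
  · simpa using this
  · intro ζ h1 h2 δ hδ
    by_cases hζ : ζ ∈ K
    · have : ∀ᶠ x in 𝓝 ζ, v x < δ :=
        hv.cont.continuousAt.eventually_lt continuousAt_const (by rw [hv.zero ζ hζ]; exact hδ)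
      filter_upwards [mem_nhdsWithin_of_mem_nhds this, self_mem_nhdsWithin] with x hx hx2
      have := (abs_nonneg _).trans (hHi x hx2.1)
      linarith
    · have h3 : S ≤ ‖ζ‖ := by
        by_contra h; exact h1 ⟨hζ, by simpa using h⟩
      have h4 : v ζ - H ζ < δ := by
        rw [hR ζ ((le_max_left _ _).trans h3)]
        linarith [hHi ζ hζ]
      exact mem_nhdsWithin_of_mem_nhds
        ((hv.cont.continuousAt.sub (hHc ζ hζ)).eventually_lt continuousAt_const h4)

end fam

noncomputable def US (K : Set ℂ) (z : ℂ) : ℝ := sSup {t | ∃ v, Fam K v ∧ t = v z}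

structure Setup (K : Set ℂ) (H : ℂ → ℝ) : Prop where
  real : ∀ z ∈ K, z.im = 0
  closed : IsClosed K
  harm : HarmonicOnNhd H Kᶜ
  ge : ∀ z ∉ K, |z.im| ≤ H z

section us
variable {K : Set ℂ} {H : ℂ → ℝ}

lemma US_bdd (S : Setup K H) (z : ℂ) : BddAbove {t | ∃ v, Fam K v ∧ t = v z} := by
  refine ⟨max (H z) 0, ?_⟩
  rintro _ ⟨v, hv, rfl⟩
  by_cases hz : z ∈ K
  · rw [hv.zero z hz]; exact le_max_right _ _
  · exact (hv.le_H S.closed S.harm S.ge z hz).trans (le_max_left _ _)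

lemma Fam.le_US (S : Setup K H) {v : ℂ → ℝ} (hv : Fam K v) (z : ℂ) : v z ≤ US K z :=
  le_csSup (US_bdd S z) ⟨v, hv, rfl⟩

lemma US_le (S : Setup K H) {z : ℂ} {c : ℝ} (h : ∀ v, Fam K v → v z ≤ c) : US K z ≤ c := by
  apply csSup_le
  · exact ⟨_, _, fam_abs S.real, rfl⟩
  · rintro _ ⟨v, hv, rfl⟩; exact h v hv

lemma US_ge (S : Setup K H) (z : ℂ) : |z.im| ≤ US K z := (fam_abs S.real).le_US S z

lemma US_nonneg (S : Setup K H) (z : ℂ) : 0 ≤ US K z := (abs_nonneg _).trans (US_ge S z)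

lemma US_zero (S : Setup K H) {z : ℂ} (hz : z ∈ K) : US K z = 0 :=
  le_antisymm (US_le S fun v hv => (hv.zero z hz).le) (US_nonneg S z)

lemma US_le_H (S : Setup K H) {z : ℂ} (hz : z ∉ K) : US K z ≤ H z :=
  US_le S fun v hv => hv.le_H S.closed S.harm S.ge z hz

lemma US_conj (S : Setup K H) (z : ℂ) : US K ((starRingEnd ℂ) z) = US K z := by
  have key : ∀ z, US K ((starRingEnd ℂ) z) ≤ US K z := fun z =>
    US_le S fun v hv => (hv.conj S.real).le_US S z
  refine le_antisymm (key z) ?_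
  simpa using key ((starRingEnd ℂ) z)

lemma US_mono_im (S : Setup K H) {x y y' : ℝ} (h0 : 0 ≤ y') (h : y' ≤ y) : US K ⟨x, y'⟩ ≤ US K ⟨x, y⟩ := by
  rcases h.eq_or_lt with rfl | h
  · rfl
  refine US_le S fun v hv => ?_
  have h1 := (hv.tr S.real (s := (y + y') / 2) (by linarith)).le_US S ⟨x, y⟩
  refine le_trans ?_ h1
  unfold Tr
  rw [if_pos (by simp; linarith)]
  have : (starRingEnd ℂ) (⟨x, y⟩ : ℂ) + (2 * ((y + y') / 2) : ℝ) * I = ⟨x, y'⟩ := by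
    apply Complex.ext <;> simp
    ring
  rw [this]
  exact le_max_right _ _

lemma US_harnack (S : Setup K H) {z w : ℂ} {r : ℝ} (hr : 0 < r) (hb : closedBall z (2 * r) ⊆ Kᶜ)
    (hw : w ∈ ball z r) :
    US K w ≤ (r + ‖w - z‖) / (r - ‖w - z‖) * US K z ∧
    US K z ≤ (r + ‖w - z‖) / (r - ‖w - z‖) * US K w := by
  have hd : ‖w - z‖ < r := by simpa [dist_eq_norm] using hw
  have hρ : 0 ≤ (r + ‖w - z‖) / (r - ‖w - z‖) :=
    div_nonneg (by positivity) (by linarith)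
  have key : ∀ v, Fam K v → ∃ v', Fam K v' ∧ (∀ x, v x ≤ v' x) ∧
      v' w ≤ (r + ‖w - z‖) / (r - ‖w - z‖) * v' z ∧
      v' z ≤ (r + ‖w - z‖) / (r - ‖w - z‖) * v' w := by
    intro v hv
    have h2r : 0 < 2 * r := by linarith
    have hv' := hv.pmod h2r hb
    refine ⟨_, hv', le_pmod h2r hv.cont
      (fun x hx => hv.sub x (hb (ball_subset_closedBall hx))), ?_⟩
    apply harnack hw
    · intro x hx
      exact pmod_harm h2r hv.cont x (closedBall_subset_ball (by linarith) hx)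
    · intro x _
      exact (abs_nonneg _).trans (hv'.ge x)
  constructor
  · refine US_le S fun v hv => ?_
    obtain ⟨v', h1, h2, h3, h4⟩ := key v hv
    exact (h2 w).trans (h3.trans (mul_le_mul_of_nonneg_left (h1.le_US S z) hρ))
  · refine US_le S fun v hv => ?_
    obtain ⟨v', h1, h2, h3, h4⟩ := key v hv
    exact (h2 z).trans (h4.trans (mul_le_mul_of_nonneg_left (h1.le_US S w) hρ))

lemma exists_ball (S : Setup K H) {z : ℂ} (hz : z ∉ K) : ∃ r > 0, closedBall z (2 * r) ⊆ Kᶜ := by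
  obtain ⟨ε, hε, h⟩ := Metric.nhds_basis_closedBall.mem_iff.1 (S.closed.isOpen_compl.mem_nhds hz)
  exact ⟨ε / 2, by linarith, by rwa [mul_div_cancel₀ _ (by norm_num : (2:ℝ) ≠ 0)]⟩

lemma US_contAt (S : Setup K H) {z : ℂ} (hz : z ∉ K) : ContinuousAt (US K) z := by
  obtain ⟨r, hr, hb⟩ := exists_ball S hz
  have hρ : ContinuousAt (fun w : ℂ => (r + ‖w - z‖) / (r - ‖w - z‖)) z := by
    apply ContinuousAt.div (by fun_prop) (by fun_prop)
    simp; exact hr.ne'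
  have hρ' : ContinuousAt (fun w : ℂ => (r - ‖w - z‖) / (r + ‖w - z‖)) z := by
    apply ContinuousAt.div (by fun_prop) (by fun_prop)
    simp; exact hr.ne'
  have h1 : Tendsto (fun w : ℂ => (r + ‖w - z‖) / (r - ‖w - z‖) * US K z) (𝓝 z) (𝓝 (US K z)) := by
    have := hρ.tendsto.mul_const (US K z)
    simpa [hr.ne'] using this
  have h2 : Tendsto (fun w : ℂ => (r - ‖w - z‖) / (r + ‖w - z‖) * US K z) (𝓝 z) (𝓝 (US K z)) := by
    have := hρ'.tendsto.mul_const (US K z)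
    simpa [hr.ne'] using this
  refine tendsto_of_tendsto_of_tendsto_of_le_of_le' h2 h1 ?_ ?_
  · filter_upwards [ball_mem_nhds z hr] with w hw
    have hd : ‖w - z‖ < r := by simpa [dist_eq_norm] using hw
    have := (US_harnack S hr hb hw).2
    rw [div_mul_eq_mul_div, le_div_iff₀ (by linarith)] at this
    rw [div_mul_eq_mul_div, div_le_iff₀ (by positivity)]
    linarith
  · filter_upwards [ball_mem_nhds z hr] with w hw
    exact (US_harnack S hr hb hw).1

lemma US_approx (S : Setup K H) {C : Set ℂ} (hC : IsCompact C) (hCK : C ⊆ Kᶜ) {ε : ℝ} (hε : 0 < ε) :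
    ∃ v, Fam K v ∧ ∀ z ∈ C, US K z - ε ≤ v z := by
  refine hC.induction_on (p := fun s => ∃ v, Fam K v ∧ ∀ z ∈ s, US K z - ε ≤ v z) ?_ ?_ ?_ ?_
  · exact ⟨_, fam_abs S.real, by simp⟩
  · rintro s t hst ⟨v, hv, h⟩
    exact ⟨v, hv, fun z hz => h z (hst hz)⟩
  · rintro s t ⟨v, hv, h⟩ ⟨v', hv', h'⟩
    refine ⟨_, hv.max hv', ?_⟩
    rintro z (hz | hz)
    · exact (h z hz).trans (le_max_left _ _)
    · exact (h' z hz).trans (le_max_right _ _)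
  · intro z hz
    have : ∃ v, Fam K v ∧ US K z - ε < v z := by
      by_contra hcon
      push Not at hcon
      have := US_le S hcon
      linarith
    obtain ⟨v, hv, h⟩ := this
    have hc : ContinuousAt (fun w => US K w - ε) z := (US_contAt S (hCK hz)).sub continuousAt_const
    exact ⟨_, mem_nhdsWithin_of_mem_nhds (hc.eventually_lt hv.cont.continuousAt h), v, hv,
      fun w hw => le_of_lt hw⟩

lemma US_harm (S : Setup K H) : HarmonicOnNhd (US K) Kᶜ := by
  intro z0 hz0
  obtain ⟨r, hr, hb⟩ := exists_ball S hz0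
  have h2r : 0 < 2 * r := by linarith
  have hbr : closedBall z0 r ⊆ ball z0 (2 * r) := closedBall_subset_ball (by linarith)
  have hbr' : closedBall z0 r ⊆ Kᶜ := hbr.trans (ball_subset_closedBall.trans hb)
  have hUc : ContinuousOn (US K) (sphere z0 r) := fun x hx =>
    (US_contAt S (hbr' (sphere_subset_closedBall hx))).continuousWithinAt
  have key : ∀ w ∈ ball z0 r, PI (US K) z0 r w = US K w := by
    intro w hw
    have hwb := ball_subset_closedBall hw
    have hab : ∀ ε > 0, PI (US K) z0 r w ≤ US K w + ε ∧ US K w ≤ PI (US K) z0 r w + ε := by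
      intro ε hε
      obtain ⟨v, hv, h⟩ := US_approx S (isCompact_closedBall z0 r) hbr' hε
      have hv' := hv.pmod h2r hb
      have hle := le_pmod h2r hv.cont
        (fun x hx => hv.sub x (hb (ball_subset_closedBall hx)))
      have hh : HarmonicOnNhd (pmod v z0 (2 * r)) (closedBall z0 r) := fun x hx =>
        pmod_harm h2r hv.cont x (hbr hx)
      have hh' : HarmonicOnNhd (fun x => pmod v z0 (2 * r) x + ε) (closedBall z0 r) := fun x hx =>
        (hh x hx).add (harmonicAt_const ε)
      have h1 := PI_mono hw hUc (hv'.cont.add continuous_const).continuousOn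
        (φ := US K) (ψ := fun x => pmod v z0 (2 * r) x + ε) (fun x hx => by
          have := h x (sphere_subset_closedBall hx)
          have := hle x
          linarith)
      have h2 := PI_mono hw hv'.cont.continuousOn hUc (fun x hx => hv'.le_US S x)
      rw [PI_harm hw hh'] at h1
      rw [PI_harm hw hh] at h2
      have h3 := hv'.le_US S w
      have h4 := h w hwb
      have h5 := hle w
      constructor <;> linarith
    exact le_antisymm (le_of_forall_pos_le_add fun ε hε => (hab ε hε).1)
      (le_of_forall_pos_le_add fun ε hε => (hab ε hε).2)
  refine (harmonicAt_congr_nhds ?_).1 (PI_harmonicOn hr hUc z0 (mem_ball_self hr))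
  filter_upwards [ball_mem_nhds z0 hr] with w hw
  exact key w hw

lemma US_pos (S : Setup K H) {z : ℂ} (hz : z ∉ K) : 0 < US K z := by
  obtain ⟨r, hr, hb⟩ := exists_ball S hz
  set w : ℂ := z + (if 0 ≤ z.im then (r / 2 : ℝ) else (-(r / 2) : ℝ)) * I with hw
  have h1 : w ∈ ball z r := by
    rw [hw, mem_ball, dist_eq_norm, add_sub_cancel_left]
    split_ifs <;> simp <;> rw [abs_of_pos hr] <;> linarith
  have h2 : 0 < |w.im| := by
    rw [abs_pos, hw]
    split_ifs with h <;> simp <;> linarith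
  have h3 := (US_harnack S hr hb h1).1
  have h4 := US_ge S w
  by_contra h5
  have h6 : US K z = 0 := le_antisymm (not_lt.1 h5) (US_nonneg S z)
  rw [h6, mul_zero] at h3
  linarith

end us

section bdry
variable {K : Set ℂ} {H : ℂ → ℝ}

lemma fam_bound (S : Setup K H) {c : ℂ} {R : ℝ} (hs : sphere c R ⊆ Kᶜ) :
    ∃ M : ℝ, 0 ≤ M ∧ ∀ v, Fam K v → ∀ z ∈ ball c R, v z ≤ M := by
  have hHc : ∀ x ∉ K, ContinuousAt H x := fun x hx => (S.harm x hx).1.continuousAt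
  obtain ⟨M0, hM0⟩ := (isCompact_sphere c R).bddAbove_image
    (f := H) (fun x hx => (hHc x (hs hx)).continuousWithinAt)
  refine ⟨max M0 0, le_max_right _ _, fun v hv z hz => ?_⟩
  set M := max M0 0
  have hM : 0 ≤ M := le_max_right _ _
  by_cases hzK : z ∈ K
  · rw [hv.zero z hzK]; exact hM
  have := max_principle (w := fun x => v x - M) (Ω := Kᶜ ∩ ball c R)
    (S.closed.isOpen_compl.inter isOpen_ball) (isBounded_ball.subset inter_subset_right)
    (hv.cont.sub continuous_const).continuousOn
    (fun x hx => (hv.sub x hx.1).sub_harm (harmonicAt_const M)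
      (Eventually.of_forall fun y => hv.cont.continuousAt)) ?_ z ⟨hzK, hz⟩
  · simpa using this
  · intro ζ h1 h2 δ hδ
    have h4 : v ζ - M < δ := by
      by_cases hζ : ζ ∈ K
      · rw [hv.zero ζ hζ]; linarith
      · have h3 : ζ ∈ sphere c R := by
          have h5 : ζ ∈ closedBall c R := closure_ball_subset_closedBall
            (closure_mono inter_subset_right h2)
          have h6 : ζ ∉ ball c R := fun h => h1 ⟨hζ, h⟩
          simp only [mem_closedBall, mem_ball, mem_sphere] at *
          exact le_antisymm h5 (not_lt.1 h6)
        have h7 : H ζ ≤ M0 := hM0 ⟨ζ, h3, rfl⟩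
        have h8 := hv.le_H S.closed S.harm S.ge ζ hζ
        have h9 : M0 ≤ M := le_max_left _ _
        linarith
    exact mem_nhdsWithin_of_mem_nhds
      ((hv.cont.continuousAt.sub continuousAt_const).eventually_lt continuousAt_const h4)

lemma cbrt_re (z : ℂ) : ‖z‖ ^ (1 / 3 : ℝ) / 2 ≤ (z ^ (1 / 3 : ℂ)).re ∧
    (z ^ (1 / 3 : ℂ)).re ≤ ‖z‖ ^ (1 / 3 : ℝ) := by
  have h13 : (1 / 3 : ℂ) = ((1 / 3 : ℝ) : ℂ) := by push_cast; rfl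
  rw [h13]
  have hre : (z ^ (((1 / 3 : ℝ)) : ℂ)).re = ‖z‖ ^ (1 / 3 : ℝ) * Real.cos (z.arg * (1 / 3)) :=
    Complex.cpow_ofReal_re z (1 / 3)
  have hc : 1 / 2 ≤ Real.cos (z.arg * (1 / 3)) := by
    rw [← Real.cos_abs, ← Real.cos_pi_div_three]
    apply Real.cos_le_cos_of_nonneg_of_le_pi (abs_nonneg _) (by linarith [Real.pi_pos])
    rw [abs_mul, abs_of_pos (by norm_num : (0:ℝ) < 1 / 3)]
    have := Complex.abs_arg_le_pi z
    linarith
  have hp : 0 ≤ ‖z‖ ^ (1 / 3 : ℝ) := by positivity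
  rw [hre]
  constructor
  · nlinarith
  · nlinarith [Real.cos_le_one (z.arg * (1 / 3))]

lemma barrier (s x0 : ℂ) (hs : ‖s‖ = 1) : ∃ β : ℂ → ℝ,
    (∀ z, s * (z - x0) ∈ slitPlane → HarmonicAt β z) ∧ (∀ z, 0 ≤ β z) ∧
    Tendsto β (𝓝 x0) (𝓝 0) ∧ ∀ η > 0, ∃ m > 0, ∀ z, ‖z - x0‖ = η → m ≤ β z := by
  refine ⟨fun z => ((s * (z - x0)) ^ (1 / 3 : ℂ)).re, ?_, ?_, ?_, ?_⟩
  · intro z hz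
    apply AnalyticAt.harmonicAt_re
    exact AnalyticAt.cpow (by fun_prop) analyticAt_const hz
  · intro z
    exact le_trans (by positivity) (cbrt_re _).1
  · have h0 : Tendsto (fun z : ℂ => ‖s * (z - x0)‖ ^ (1 / 3 : ℝ)) (𝓝 x0) (𝓝 0) := by
      have : ContinuousAt (fun z : ℂ => ‖s * (z - x0)‖ ^ (1 / 3 : ℝ)) x0 := by
        apply ContinuousAt.rpow_const (by fun_prop)
        right; norm_num
      have h := this.tendsto
      simp only [sub_self, mul_zero, norm_zero] at h
      rwa [Real.zero_rpow (by norm_num)] at h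
    exact squeeze_zero (fun z => le_trans (by positivity) (cbrt_re _).1) (fun z => (cbrt_re _).2) h0
  · intro η hη
    refine ⟨η ^ (1 / 3 : ℝ) / 2, by positivity, fun z hz => ?_⟩
    have := (cbrt_re (s * (z - x0))).1
    rwa [norm_mul, hs, one_mul, hz] at this

lemma US_cont_bdry (S : Setup K H) {c x0 s : ℂ} {R η : ℝ} (hsph : sphere c R ⊆ Kᶜ) (hs : ‖s‖ = 1)
    (hη : 0 < η) (hb : closedBall x0 η ⊆ ball c R) (hx0 : x0 ∈ K)
    (hseg : ∀ z ∈ closedBall x0 η, s * (z - x0) ∉ slitPlane → z ∈ K) :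
    ContinuousAt (US K) x0 := by
  obtain ⟨M, hM, hv⟩ := fam_bound S hsph
  obtain ⟨β, hβh, hβ0, hβt, hβm⟩ := barrier s x0 hs
  obtain ⟨m, hm, hβm⟩ := hβm η hη
  have hC : 0 ≤ M / m := by positivity
  have hharm : ∀ z ∈ closedBall x0 η, z ∉ K → HarmonicAt (fun x => M / m * β x) z := by
    intro z hz hzK
    have : HarmonicAt β z := hβh z (by by_contra h; exact hzK (hseg z hz h))
    exact this.const_smul (c := M / m)
  have key : ∀ z ∈ ball x0 η, US K z ≤ M / m * β z := by
    intro z hz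
    refine US_le S fun v hvF => ?_
    by_cases hzK : z ∈ K
    · rw [hvF.zero z hzK]; exact mul_nonneg hC (hβ0 z)
    have := max_principle (w := fun x => v x - M / m * β x) (Ω := Kᶜ ∩ ball x0 η)
      (S.closed.isOpen_compl.inter isOpen_ball) (isBounded_ball.subset inter_subset_right)
      (fun x hx => (hvF.cont.continuousAt.sub
        (hharm x (ball_subset_closedBall hx.2) hx.1).1.continuousAt).continuousWithinAt)
      (fun x hx => (hvF.sub x hx.1).sub_harm (hharm x (ball_subset_closedBall hx.2) hx.1)
        (Eventually.of_forall fun y => hvF.cont.continuousAt)) ?_ z ⟨hzK, hz⟩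
    · simpa using this
    · intro ζ h1 h2 δ hδ
      by_cases hζ : ζ ∈ K
      · have : ∀ᶠ x in 𝓝 ζ, v x < δ :=
          hvF.cont.continuousAt.eventually_lt continuousAt_const (by rw [hvF.zero ζ hζ]; exact hδ)
        filter_upwards [mem_nhdsWithin_of_mem_nhds this] with x hx
        have := mul_nonneg hC (hβ0 x)
        linarith
      · have h5 : ζ ∈ closedBall x0 η := closure_ball_subset_closedBall
            (closure_mono inter_subset_right h2)
        have h3 : ‖ζ - x0‖ = η := by
          have h6 : ζ ∉ ball x0 η := fun h => h1 ⟨hζ, h⟩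
          simp only [mem_closedBall, mem_ball, dist_eq_norm] at h5 h6
          exact le_antisymm h5 (not_lt.1 h6)
        have h4 : v ζ - M / m * β ζ < δ := by
          have h6 := hv v hvF ζ (hb h5)
          have h7 : M / m * m ≤ M / m * β ζ := mul_le_mul_of_nonneg_left (hβm ζ h3) hC
          rw [div_mul_cancel₀ _ hm.ne'] at h7
          linarith
        exact mem_nhdsWithin_of_mem_nhds
          ((hvF.cont.continuousAt.sub (hharm ζ h5 hζ).1.continuousAt).eventually_lt
            continuousAt_const h4)
  unfold ContinuousAt
  rw [US_zero S hx0]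
  have h1 : Tendsto (fun z => M / m * β z) (𝓝 x0) (𝓝 0) := by
    simpa using hβt.const_mul (M / m)
  refine squeeze_zero' (Eventually.of_forall fun z => US_nonneg S z) ?_ h1
  filter_upwards [ball_mem_nhds x0 hη] with z hz using key z hz

end bdry

section geom

variable {a b : ℕ → ℝ}

lemma geom_lf
    (hdist : Tendsto (fun m => Metric.infDist (0 : ℝ) (Icc (a m) (b m))) atTop atTop) :
    LocallyFinite fun m => Icc (a m) (b m) := by
  intro x
  refine ⟨ball x 1, ball_mem_nhds x one_pos, ?_⟩
  have h := hdist.eventually_gt_atTop (|x| + 1)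
  rw [← Nat.cofinite_eq_atTop, eventually_cofinite] at h
  refine h.subset ?_
  rintro m ⟨y, hy1, hy2⟩
  rw [Set.mem_ofPred_eq, not_lt]
  refine (Metric.infDist_le_dist_of_mem hy1).trans ?_
  have h1 : |y - x| < 1 := by simpa [Real.dist_eq] using hy2
  have h2 : |y| ≤ |y - x| + |x| := by simpa using abs_add_le (y - x) x
  rw [dist_comm, Real.dist_eq, sub_zero]
  linarith

lemma cplx_closed {E : Set ℝ} (hE : IsClosed E) : IsClosed (cplx E) :=
  Complex.isometry_ofReal.isClosedEmbedding.isClosedMap _ hE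

lemma cplx_mem {E : Set ℝ} {z : ℂ} : z ∈ cplx E ↔ z.im = 0 ∧ z.re ∈ E := by
  constructor
  · rintro ⟨x, hx, rfl⟩; simp [hx]
  · rintro ⟨h1, h2⟩
    exact ⟨z.re, h2, by apply Complex.ext <;> simp [h1]⟩

/-- For each interval, a slightly larger interval whose ends avoid `E`. -/
lemma geom_gap (hab : ∀ m, a m < b m)
    (hdisj : ∀ m n, m ≠ n → Disjoint (Icc (a m) (b m)) (Icc (a n) (b n)))
    (hdist : Tendsto (fun m => Metric.infDist (0 : ℝ) (Icc (a m) (b m))) atTop atTop) (m : ℕ) :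
    ∃ ε > 0, a m - ε ∉ (⋃ n, Icc (a n) (b n)) ∧ b m + ε ∉ (⋃ n, Icc (a n) (b n)) := by
  have hcl : IsClosed (⋃ n : {n // n ≠ m}, Icc (a n) (b n)) :=
    ((geom_lf hdist).comp_injective Subtype.val_injective).isClosed_iUnion
      fun n => isClosed_Icc
  have hne : ∀ x ∈ Icc (a m) (b m), x ∉ (⋃ n : {n // n ≠ m}, Icc (a n) (b n)) := by
    intro x hx h
    obtain ⟨n, hn⟩ := mem_iUnion.1 h
    exact (Set.disjoint_left.1 (hdisj m n (Ne.symm n.2))) hx hn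
  have h1 := hcl.isOpen_compl.mem_nhds (hne (a m) ⟨le_rfl, (hab m).le⟩)
  have h2 := hcl.isOpen_compl.mem_nhds (hne (b m) ⟨(hab m).le, le_rfl⟩)
  obtain ⟨ε1, hε1, h1⟩ := Metric.mem_nhds_iff.1 h1
  obtain ⟨ε2, hε2, h2⟩ := Metric.mem_nhds_iff.1 h2
  have hε : 0 < min ε1 ε2 / 2 := by positivity
  have hl1 := min_le_left ε1 ε2
  have hl2 := min_le_right ε1 ε2
  refine ⟨min ε1 ε2 / 2, hε, ?_, ?_⟩
  · intro h
    obtain ⟨n, hn⟩ := mem_iUnion.1 h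
    by_cases hnm : n = m
    · subst hnm; linarith [hn.1]
    · refine h1 ?_ (mem_iUnion.2 ⟨⟨n, hnm⟩, hn⟩)
      rw [mem_ball, Real.dist_eq, abs_lt]; constructor <;> linarith
  · intro h
    obtain ⟨n, hn⟩ := mem_iUnion.1 h
    by_cases hnm : n = m
    · subst hnm; linarith [hn.2]
    · refine h2 ?_ (mem_iUnion.2 ⟨⟨n, hnm⟩, hn⟩)
      rw [mem_ball, Real.dist_eq, abs_lt]; constructor <;> linarith

lemma geom_pt (hab : ∀ m, a m < b m)
    (hdisj : ∀ m n, m ≠ n → Disjoint (Icc (a m) (b m)) (Icc (a n) (b n)))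
    (hdist : Tendsto (fun m => Metric.infDist (0 : ℝ) (Icc (a m) (b m))) atTop atTop)
    {x0 : ℂ} (hx0 : x0 ∈ cplx (⋃ n, Icc (a n) (b n))) :
    ∃ (c s : ℂ) (R η : ℝ), sphere c R ⊆ (cplx (⋃ n, Icc (a n) (b n)))ᶜ ∧ ‖s‖ = 1 ∧ 0 < η ∧
      closedBall x0 η ⊆ ball c R ∧
      (∀ z ∈ closedBall x0 η, s * (z - x0) ∉ slitPlane → z ∈ cplx (⋃ n, Icc (a n) (b n))) := by
  obtain ⟨x, hx, rfl⟩ := hx0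
  obtain ⟨m, hm⟩ := mem_iUnion.1 hx
  obtain ⟨ε, hε, he1, he2⟩ := geom_gap hab hdisj hdist m
  have habm := hab m
  have hd : ∀ z : ℂ, ∀ η : ℝ, z ∈ closedBall (x : ℂ) η → |z.re - x| ≤ η := by
    intro z η hz
    have h1 : ‖z - x‖ ≤ η := by simpa [dist_eq_norm] using hz
    have h2 := Complex.abs_re_le_norm (z - x)
    simp at h2
    linarith
  have hsph : sphere (((a m + b m) / 2 : ℝ) : ℂ) ((b m - a m) / 2 + ε) ⊆
      (cplx (⋃ n, Icc (a n) (b n)))ᶜ := by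
    rintro z hz ⟨y, hy, rfl⟩
    rw [mem_sphere, dist_eq_norm] at hz
    simp only at hz
    rw [← Complex.ofReal_sub, Complex.norm_real, Real.norm_eq_abs] at hz
    rcases le_total 0 (y - (a m + b m) / 2) with h | h
    · rw [abs_of_nonneg h] at hz
      apply he2; convert hy using 1; linarith
    · rw [abs_of_nonpos h] at hz
      apply he1; convert hy using 1; linarith
  have hball : ∀ η, η < ε → closedBall (x : ℂ) η ⊆
      ball (((a m + b m) / 2 : ℝ) : ℂ) ((b m - a m) / 2 + ε) := by
    intro η hη
    apply closedBall_subset_ball'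
    rw [dist_eq_norm, ← Complex.ofReal_sub, Complex.norm_real, Real.norm_eq_abs]
    have : |x - (a m + b m) / 2| ≤ (b m - a m) / 2 := by
      rw [abs_le]; constructor <;> linarith [hm.1, hm.2]
    linarith
  rcases le_total x ((a m + b m) / 2) with h | h
  · refine ⟨_, -1, _, min (ε / 2) ((b m - a m) / 2), hsph, by simp, ?_, hball _ ?_, ?_⟩
    · apply lt_min <;> linarith
    · have := min_le_left (ε / 2) ((b m - a m) / 2); linarith
    · intro z hz hs
      have h1 := hd z _ hz
      have h2 := min_le_right (ε / 2) ((b m - a m) / 2)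
      rw [Complex.mem_slitPlane_iff] at hs
      push Not at hs
      simp at hs
      rw [abs_le] at h1
      exact cplx_mem.2 ⟨by linarith [hs.2], mem_iUnion.2 ⟨m, by linarith [hm.1, hs.1], by linarith⟩⟩
  · refine ⟨_, 1, _, min (ε / 2) ((b m - a m) / 2), hsph, by simp, ?_, hball _ ?_, ?_⟩
    · apply lt_min <;> linarith
    · have := min_le_left (ε / 2) ((b m - a m) / 2); linarith
    · intro z hz hs
      have h1 := hd z _ hz
      have h2 := min_le_right (ε / 2) ((b m - a m) / 2)
      rw [Complex.mem_slitPlane_iff] at hs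
      push Not at hs
      simp at hs
      rw [abs_le] at h1
      exact cplx_mem.2 ⟨by linarith [hs.2], mem_iUnion.2 ⟨m, by linarith, by linarith [hm.2, hs.1]⟩⟩

end geom

lemma exists_setup {E : Set ℝ} (hE : IsClosed E) {f : ℂ → ℂ} (hf : Differentiable ℂ f)
    (hf_growth : ∃ A B : ℝ, ∀ z : ℂ, Real.log ‖f z‖ ≤ A * ‖z‖ + B)
    (hf_type : 0 < Filter.limsup (fun z : ℂ => Real.log ‖f z‖ / ‖z‖)
      (Filter.comap (fun z : ℂ => ‖z‖) Filter.atTop))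
    (hbt : BoundedTypeOn f (cplx E)ᶜ) : ∃ H, Setup (cplx E) H := by
  obtain ⟨h, hh, hpos, hle⟩ := hbt
  obtain ⟨A, B, hg⟩ := hf_growth
  have hcl := cplx_closed hE
  rw [harmonicOn_iff hcl.isOpen_compl] at hh
  have hre : ∀ z ∈ cplx E, z.im = 0 := fun z hz => (cplx_mem.1 hz).1
  have hconj : ∀ z ∉ cplx E, (starRingEnd ℂ) z ∉ cplx E := by
    intro z hz h1
    apply hz
    rw [cplx_mem] at h1 ⊢
    simpa using h1
  set H : ℂ → ℝ := fun z => h z + h ((starRingEnd ℂ) z) with hHdef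
  have hHh : HarmonicOnNhd H (cplx E)ᶜ := fun z hz =>
    (hh z hz).add (harmonicAt_conj (hh _ (hconj z hz)))
  have hHp : ∀ z ∉ cplx E, 0 ≤ H z := fun z hz =>
    (add_pos (hpos z hz) (hpos _ (hconj z hz))).le
  have hHs : ∀ z, H ((starRingEnd ℂ) z) = H z := fun z => by simp [hHdef, add_comm]
  have hup : ∀ z : ℂ, z.im ≠ 0 → z ∉ cplx E := fun z hz h1 => hz (hre z h1)
  have hlog : ∀ z : ℂ, z.im ≠ 0 → Real.log ‖f z‖ ≤ H z := by
    intro z hz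
    have h1 := hle z (hup z hz)
    have h2 := hpos _ (hconj z (hup z hz))
    have h3 : Real.log ‖f z‖ ≤ logPlus ‖f z‖ := le_max_left _ _
    simp only [hHdef]; linarith
  rcases hp_dichotomy (H := H) (fun z hz => hHh z (hup z (ne_of_gt hz)))
    (fun z hz => hHp z (hup z hz.ne')) with ⟨κ, hκ, hk⟩ | hsmall
  · refine ⟨fun z => κ⁻¹ * H z, hre, hcl, ?_, ?_⟩
    · intro z hz
      exact (hHh z hz).const_smul (c := κ⁻¹)
    · intro z hz
      have : κ * |z.im| ≤ H z := by
        rcases lt_trichotomy z.im 0 with h1 | h1 | h1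
        · have := hk ((starRingEnd ℂ) z) (by simpa using h1)
          rw [hHs] at this
          rw [abs_of_neg h1]; simpa using this
        · rw [h1]; simpa using hHp z hz
        · rw [abs_of_pos h1]; exact hk z h1
      rw [inv_mul_eq_div, le_div_iff₀ hκ]; linarith
  · exfalso
    refine type_contra hf_type (fun ε hε => type_zero hf hg ?_ ε hε)
    intro ε hε
    obtain ⟨T, hT, hs⟩ := hsmall ε hε
    refine ⟨T, hT, fun z h1 h2 => ?_⟩
    have h3 : 0 < |z.im| := by linarith
    refine (hlog z (abs_pos.1 h3)).trans ?_
    rcases le_total 0 z.im with h4 | h4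
    · rw [abs_of_nonneg h4] at h1 h2 ⊢
      exact hs z h1 h2
    · rw [abs_of_nonpos h4] at h1 h2 ⊢
      have := hs ((starRingEnd ℂ) z) (by simpa using h1) (by simpa using h2)
      rw [hHs] at this
      simpa using this

lemma US_growth {K : Set ℂ} {H : ℂ → ℝ} (S : Setup K H) :
    ∃ A : ℝ, ∀ z : ℂ, US K z ≤ A * (1 + ‖z‖) := by
  have hup : ∀ z : ℂ, 0 < z.im → z ∉ K := fun z hz h1 => hz.ne' (S.real z h1)
  have hh : HarmonicOnNhd H {z | 0 < z.im} := fun z hz => S.harm z (hup z hz)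
  have hp : ∀ z : ℂ, 0 < z.im → 0 ≤ H z := fun z hz =>
    (abs_nonneg _).trans (S.ge z (hup z hz))
  have key : ∀ z : ℂ, 0 ≤ z.im → US K z ≤ 40 * H ⟨0, 1⟩ * (1 + ‖z‖) := by
    intro z hz
    set T := 2 * ‖z‖ + 2 with hT
    have h0 := norm_nonneg z
    have h1 : US K z ≤ US K ⟨z.re, T⟩ := by
      have h2 := Complex.im_le_norm z
      exact US_mono_im S (x := z.re) hz (by linarith)
    have h2 : US K ⟨z.re, T⟩ ≤ H ⟨z.re, T⟩ := US_le_H S (hup _ (by simp only; linarith))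
    have h3 : H ⟨z.re, T⟩ ≤ 5 * H ⟨0, T⟩ := hp_horiz hh hp (by linarith) (by
      have := Complex.abs_re_le_norm z
      rw [sub_zero]; linarith)
    have h4 := (hp_vert hh hp (x := 0) (y := 1) (T := T) one_pos (by linarith)).2
    have h5 : 5 * (4 * T / 1 * H ⟨0, 1⟩) = 40 * H ⟨0, 1⟩ * (1 + ‖z‖) := by rw [hT]; ring
    linarith
  refine ⟨40 * H ⟨0, 1⟩, fun z => ?_⟩
  rcases le_total 0 z.im with h | h
  · exact key z h
  · have := key ((starRingEnd ℂ) z) (by simpa using h)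
    rwa [US_conj S, RCLike.norm_conj] at this

theorem stmt3 (a b : ℕ → ℝ) (hab : ∀ m, a m < b m)
    (hdisj : ∀ m n, m ≠ n → Disjoint (Icc (a m) (b m)) (Icc (a n) (b n)))
    (hdist : Tendsto (fun m => Metric.infDist (0 : ℝ) (Icc (a m) (b m))) atTop atTop)
    (E : Set ℝ) (hE : E = ⋃ m, Icc (a m) (b m))
    (f : ℂ → ℂ) (hf : Differentiable ℂ f)
    (hf_growth : ∃ A B : ℝ, ∀ z : ℂ, Real.log ‖f z‖ ≤ A * ‖z‖ + B)
    (hf_int : Integrable (fun x : ℝ => logPlus ‖f (x : ℂ)‖ / (1 + x ^ 2)))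
    (hf_type : 0 < Filter.limsup (fun z : ℂ => Real.log ‖f z‖ / ‖z‖)
      (Filter.comap (fun z : ℂ => ‖z‖) Filter.atTop))
    (hbt : BoundedTypeOn f (cplx E)ᶜ) :
    ∃ u : ℂ → ℝ, ∃ κ : ℝ, 0 < κ ∧
      Continuous u ∧ (∀ x ∈ E, u (x : ℂ) = 0) ∧
      (∀ z ∈ (cplx E)ᶜ, 0 < u z) ∧ HarmonicOn u (cplx E)ᶜ ∧
      (∀ z : ℂ, u (starRingEnd ℂ z) = u z) ∧
      (∃ A : ℝ, ∀ z : ℂ, u z ≤ A * (1 + ‖z‖)) ∧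
      (∀ z : ℂ, κ * |z.im| ≤ u z) := by
  have hcl : IsClosed E := by
    rw [hE]; exact (geom_lf hdist).isClosed_iUnion fun n => isClosed_Icc
  obtain ⟨H, S⟩ := exists_setup hcl hf hf_growth hf_type hbt
  refine ⟨US (cplx E), 1, one_pos, ?_, ?_, ?_, ?_, ?_, US_growth S, ?_⟩
  · rw [continuous_iff_continuousAt]
    intro z
    by_cases hz : z ∈ cplx E
    · have hz' := hz
      rw [hE] at hz'
      obtain ⟨c, s, R, η, h1, h2, h3, h4, h5⟩ := geom_pt hab hdisj hdist hz'
      rw [← hE] at h1 h5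
      exact US_cont_bdry S h1 h2 h3 h4 hz h5
    · exact US_contAt S hz
  · exact fun x hx => US_zero S ⟨x, hx, rfl⟩
  · exact fun z hz => US_pos S hz
  · rw [harmonicOn_iff (cplx_closed hcl).isOpen_compl]
    exact US_harm S
  · exact fun z => US_conj S z
  · intro z
    rw [one_mul]; exact US_ge S z
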